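/- Let N ≥ 1 be an integer and s ∈ (0,1) with N > 2s. Then there exists a constant C > 0 (depending only on N and s) such that for every R ≥ 1, ∫_{ℝ^N ∖ B_R(0)} (1+|x|^{N+2s})^{−2} |x|^{−2s} ( ∫_{B_R(0)} ( |x|^N − |y|^N )^{−1} dy ) dx ≤ C R^{−(N+6s)}. -/

import Mathlib

open MeasureTheory Metric

open Set Filter Topology Module in
/-- The radial profile `r ↦ (1 - r ^ N) ^ (-1/2)` is integrable on the unit ball. -/
lemma integrable_indicator_inv_sqrt_one_sub_norm_pow {E : Type*} [NormedAddCommGroup E]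
    [NormedSpace ℝ E] [MeasurableSpace E] [BorelSpace E] [FiniteDimensional ℝ E] [Nontrivial E]
    (μ : Measure E) [μ.IsAddHaarMeasure] :
    Integrable (fun y : E ↦ (Iio (1 : ℝ)).indicator
      (fun r ↦ (√(1 - r ^ finrank ℝ E))⁻¹) ‖y‖) μ := by
  have hd : finrank ℝ E ≠ 0 := finrank_pos.ne'
  set d := finrank ℝ E with hd_def
  have hd' : (d : ℝ) ≠ 0 := by exact_mod_cast hd
  have hprim : IntegrableOn (fun r : ℝ ↦ r ^ (d - 1) * (√(1 - r ^ d))⁻¹) (Ioc 0 1) := by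
    refine intervalIntegral.integrableOn_deriv_of_nonneg
      (g := fun r : ℝ ↦ -(2 / d) * √(1 - r ^ d)) (by fun_prop) ?_ ?_
    · intro r hr
      have hpos : 0 < 1 - r ^ d := sub_pos.2 (pow_lt_one₀ hr.1.le hr.2 hd)
      have hsq : √(1 - r ^ d) ≠ 0 := (Real.sqrt_pos.2 hpos).ne'
      convert! ((((hasDerivAt_pow d r).const_sub 1).sqrt hpos.ne').const_mul (-(2 / d : ℝ))) using 1
      field_simp
    · intro r hr
      have := hr.1.le
      positivity
  rw [integrable_fun_norm_addHaar]
  have hind : Integrable ((Ioc (0 : ℝ) 1).indicator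
      fun r : ℝ ↦ r ^ (d - 1) * (√(1 - r ^ d))⁻¹) :=
    (integrable_indicator_iff measurableSet_Ioc).2 hprim
  refine hind.integrableOn.congr_fun (fun r (hr : 0 < r) ↦ ?_) measurableSet_Ioi
  rcases lt_trichotomy r 1 with h | rfl | h
  · simp [indicator, hr, h, h.le, hd_def]
  · simp [indicator]
  · simp [indicator, hr, h.not_ge, h.not_gt]

open Set Filter Topology Module in
/-- The radial profile `t ↦ t ^ (-N) * (t ^ N - 1) ^ (-1/2)` is integrable outside the unit
ball. -/
lemma integrable_indicator_inv_norm_pow_mul_inv_sqrt {E : Type*} [NormedAddCommGroup E]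
    [NormedSpace ℝ E] [MeasurableSpace E] [BorelSpace E] [FiniteDimensional ℝ E] [Nontrivial E]
    (μ : Measure E) [μ.IsAddHaarMeasure] :
    Integrable (fun x : E ↦ (Ioi (1 : ℝ)).indicator
      (fun t ↦ (t ^ finrank ℝ E)⁻¹ * (√(t ^ finrank ℝ E - 1))⁻¹) ‖x‖) μ := by
  have hd : finrank ℝ E ≠ 0 := finrank_pos.ne'
  set d := finrank ℝ E with hd_def
  have hd' : (d : ℝ) ≠ 0 := by exact_mod_cast hd
  have hprim : IntegrableOn
      (fun t : ℝ ↦ t ^ (d - 1) * ((t ^ d)⁻¹ * (√(t ^ d - 1))⁻¹)) (Ioi 1) := by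
    refine integrableOn_Ioi_deriv_of_nonneg
      (g := fun t : ℝ ↦ (2 / d) * Real.arctan √(t ^ d - 1)) (l := (2 / d) * (Real.pi / 2))
      ?_ ?_ ?_ ?_
    · exact (by fun_prop : Continuous fun t : ℝ ↦
        (2 / d : ℝ) * Real.arctan √(t ^ d - 1)).continuousWithinAt
    · intro t (ht : 1 < t)
      have hpos : 0 < t ^ d - 1 := sub_pos.2 (one_lt_pow₀ ht hd)
      have hsq : √(t ^ d - 1) ≠ 0 := (Real.sqrt_pos.2 hpos).ne'
      have htd : t ^ d ≠ 0 := by positivity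
      convert! ((((hasDerivAt_pow d t).sub_const 1).sqrt hpos.ne').arctan.const_mul
        (2 / d : ℝ)) using 1
      rw [Real.sq_sqrt hpos.le, add_sub_cancel]
      field_simp
    · intro t (ht : 1 < t)
      positivity
    · refine Tendsto.const_mul _ ((tendsto_nhds_of_tendsto_nhdsWithin
        Real.tendsto_arctan_atTop).comp (Real.tendsto_sqrt_atTop.comp ?_))
      exact tendsto_atTop_add_const_right _ (-1) (tendsto_pow_atTop hd)
  rw [integrable_fun_norm_addHaar]
  have hind : Integrable ((Ioi (1 : ℝ)).indicator
      fun t : ℝ ↦ t ^ (d - 1) * ((t ^ d)⁻¹ * (√(t ^ d - 1))⁻¹)) :=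
    (integrable_indicator_iff measurableSet_Ioi).2 hprim
  refine hind.integrableOn.congr_fun (fun t _ ↦ ?_) measurableSet_Ioi
  by_cases h : 1 < t <;> simp [indicator, h, hd_def]

/-- Splitting `a - b = (a - c) + (c - b)` and using `√(p * q) ≤ p + q` separates the variables
in `(a - b)⁻¹`. -/
lemma inv_sub_le_inv_sqrt_mul_inv_sqrt {a b : ℝ} (ha : 1 < a) (hb : b < 1) :
    (a - b)⁻¹ ≤ (√(a - 1))⁻¹ * (√(1 - b))⁻¹ := by
  have h1 : 0 < √(a - 1) := Real.sqrt_pos.2 (by linarith)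
  have h2 : 0 < √(1 - b) := Real.sqrt_pos.2 (by linarith)
  rw [← mul_inv]
  apply inv_anti₀ (by positivity)
  nlinarith [Real.sq_sqrt (by linarith : 0 ≤ a - 1), Real.sq_sqrt (by linarith : 0 ≤ 1 - b),
    sq_nonneg (√(a - 1) - √(1 - b))]

open Set Module in
/-- The integral of `(t ^ N - |y| ^ N)⁻¹` over a ball of radius `R < t` in dimension `N`. -/
lemma setIntegral_ball_inv_pow_sub_norm_pow_le {E : Type*} [NormedAddCommGroup E]
    [NormedSpace ℝ E] [MeasurableSpace E] [BorelSpace E] [FiniteDimensional ℝ E] [Nontrivial E]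
    (μ : Measure E) [μ.IsAddHaarMeasure] {R t : ℝ} (hR : 0 < R) (ht : R < t) :
    ∫ y in ball (0 : E) R, (t ^ finrank ℝ E - ‖y‖ ^ finrank ℝ E)⁻¹ ∂μ ≤
      (√((t / R) ^ finrank ℝ E - 1))⁻¹ *
        ∫ y : E, (Iio (1 : ℝ)).indicator (fun r ↦ (√(1 - r ^ finrank ℝ E))⁻¹) ‖y‖ ∂μ := by
  have hd : finrank ℝ E ≠ 0 := finrank_pos.ne'
  have hint := integrable_indicator_inv_sqrt_one_sub_norm_pow μ
  set d := finrank ℝ E with hd_def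
  set h : ℝ → ℝ := (Iio (1 : ℝ)).indicator (fun r ↦ (√(1 - r ^ d))⁻¹) with hh
  set c := (√((t / R) ^ d - 1))⁻¹
  have htR : 1 < (t / R) ^ d := one_lt_pow₀ ((one_lt_div hR).2 ht) hd
  calc ∫ y in ball (0 : E) R, (t ^ d - ‖y‖ ^ d)⁻¹ ∂μ
      = ∫ y, (ball (0 : E) R).indicator (fun y ↦ (t ^ d - ‖y‖ ^ d)⁻¹) y ∂μ :=
        (integral_indicator measurableSet_ball).symm
    _ ≤ ∫ y, (R ^ d)⁻¹ * c * h ‖R⁻¹ • y‖ ∂μ := by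
        refine integral_mono_of_nonneg (.of_forall fun y ↦ ?_)
          ((hint.comp_smul (inv_ne_zero hR.ne')).const_mul _) (.of_forall fun y ↦ ?_)
        · refine indicator_nonneg (fun y hy ↦ ?_) y
          rw [mem_ball_zero_iff] at hy
          exact inv_nonneg.2 (sub_nonneg.2
            (pow_le_pow_left₀ (norm_nonneg y) (hy.trans ht).le d))
        · have hnorm : ‖R⁻¹ • y‖ = ‖y‖ / R := by
            rw [norm_smul, norm_inv, Real.norm_of_nonneg hR.le, inv_mul_eq_div]
          simp only [hnorm]
          by_cases hy : ‖y‖ < R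
          · have hyR : ‖y‖ / R < 1 := (div_lt_one hR).2 hy
            have hlt : (‖y‖ / R) ^ d < 1 := pow_lt_one₀ (by positivity) hyR hd
            rw [indicator_of_mem (by simpa using hy), hh, indicator_of_mem (by simpa using hyR),
              mul_assoc]
            calc (t ^ d - ‖y‖ ^ d)⁻¹ = (R ^ d)⁻¹ * ((t / R) ^ d - (‖y‖ / R) ^ d)⁻¹ := by
                  rw [← mul_inv, mul_sub, div_pow, div_pow, mul_div_cancel₀ _ (by positivity),
                    mul_div_cancel₀ _ (by positivity)]
              _ ≤ _ := by
                  gcongr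
                  exact inv_sub_le_inv_sqrt_mul_inv_sqrt htR hlt
          · have hyR : ¬ ‖y‖ / R < 1 := by rwa [div_lt_one hR]
            rw [indicator_of_notMem (by simpa using hy), hh,
              indicator_of_notMem (by simpa using hyR), mul_zero]
    _ = c * ∫ y : E, h ‖y‖ ∂μ := by
        rw [integral_const_mul, Measure.integral_comp_inv_smul_of_nonneg μ (fun y ↦ h ‖y‖) hR.le,
          smul_eq_mul, ← hd_def]
        field_simp

/-- The decaying weight in the interaction integral, evaluated at `t = R * u`. -/
lemma inv_one_add_rpow_sq_mul_inv_rpow_le {N : ℕ} {s R t : ℝ} (hs : 0 < s) (hR : 0 < R)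
    (ht : R ≤ t) :
    ((1 + t ^ ((N : ℝ) + 2 * s)) ^ 2)⁻¹ * (t ^ (2 * s))⁻¹ ≤
      R ^ (-(2 * (N : ℝ) + 6 * s)) * ((t / R) ^ N)⁻¹ := by
  have ht0 : 0 < t := hR.trans_le ht
  calc ((1 + t ^ ((N : ℝ) + 2 * s)) ^ 2)⁻¹ * (t ^ (2 * s))⁻¹
      ≤ ((t ^ ((N : ℝ) + 2 * s)) ^ 2)⁻¹ * (t ^ (2 * s))⁻¹ := by
        gcongr
        linarith
    _ = t ^ (-((N : ℝ) + 6 * s)) * (t ^ N)⁻¹ := by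
        rw [← Real.rpow_natCast t N, ← Real.rpow_natCast _ 2, ← Real.rpow_mul ht0.le,
          ← Real.rpow_neg ht0.le, ← Real.rpow_neg ht0.le, ← Real.rpow_neg ht0.le,
          ← Real.rpow_add ht0, ← Real.rpow_add ht0]
        congr 1
        push_cast
        ring
    _ ≤ R ^ (-((N : ℝ) + 6 * s)) * (t ^ N)⁻¹ := by
        gcongr ?_ * _
        exact Real.rpow_le_rpow_of_nonpos hR ht (by linarith [(Nat.cast_nonneg N : (0 : ℝ) ≤ N)])
    _ = R ^ (-(2 * (N : ℝ) + 6 * s)) * ((t / R) ^ N)⁻¹ := by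
        rw [show -((N : ℝ) + 6 * s) = -(2 * (N : ℝ) + 6 * s) + N by ring, Real.rpow_add hR,
          Real.rpow_natCast, div_pow, inv_div, div_eq_mul_inv]
        ring

/-- Double-integral estimate (Remark 4.3) used to bound the interaction term
`τ_{ε,ξ}` between the peak and the boundary. -/
theorem double_integral_interaction_estimate
    (N : ℕ) (hN : 1 ≤ N) (s : ℝ) (hs0 : 0 < s) (hs1 : s < 1)
    (hNs : 2 * s < (N : ℝ)) :
    ∃ C : ℝ, 0 < C ∧
      ∀ R : ℝ, 1 ≤ R →
        (∫ x in (ball (0 : EuclideanSpace ℝ (Fin N)) R)ᶜ,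
            ((1 + ‖x‖ ^ ((N : ℝ) + 2 * s)) ^ 2)⁻¹ * (‖x‖ ^ (2 * s))⁻¹ *
              ∫ y in ball (0 : EuclideanSpace ℝ (Fin N)) R,
                (‖x‖ ^ (N : ℝ) - ‖y‖ ^ (N : ℝ))⁻¹) ≤
          C * R ^ (-((N : ℝ) + 6 * s)) := by
  have : Nonempty (Fin N) := ⟨⟨0, hN⟩⟩
  have hfin : Module.finrank ℝ (EuclideanSpace ℝ (Fin N)) = N := finrank_euclideanSpace_fin
  have hg := integrable_indicator_inv_norm_pow_mul_inv_sqrt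
    (volume : Measure (EuclideanSpace ℝ (Fin N)))
  have hinner := fun R t hR ht ↦ setIntegral_ball_inv_pow_sub_norm_pow_le
    (volume : Measure (EuclideanSpace ℝ (Fin N))) (R := R) (t := t) hR ht
  rw [hfin] at hg hinner
  set K := ∫ y : EuclideanSpace ℝ (Fin N),
    (Set.Iio (1 : ℝ)).indicator (fun r ↦ (√(1 - r ^ N))⁻¹) ‖y‖
  set g : ℝ → ℝ := (Set.Ioi (1 : ℝ)).indicator (fun t ↦ (t ^ N)⁻¹ * (√(t ^ N - 1))⁻¹) with hgdef
  have hK : 0 ≤ K := integral_nonneg fun y ↦ Set.indicator_nonneg (fun _ _ ↦ by positivity) _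
  have hg0 : ∀ t, 0 ≤ g t := fun t ↦ by
    by_cases h : 1 < t
    · rw [hgdef, Set.indicator_of_mem (by exact h)]
      positivity
    · rw [hgdef, Set.indicator_of_notMem (by exact h)]
  set L := ∫ x : EuclideanSpace ℝ (Fin N), g ‖x‖
  have hL : 0 ≤ L := integral_nonneg fun x ↦ hg0 _
  refine ⟨K * L + 1, by positivity, fun R hR1 ↦ ?_⟩
  have hR : 0 < R := by linarith
  simp only [Real.rpow_natCast]
  have hint := (hg.comp_smul (inv_ne_zero hR.ne')).const_mul (R ^ (-(2 * (N : ℝ) + 6 * s)) * K)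
  have hsphere : ∀ᵐ x : EuclideanSpace ℝ (Fin N), x ∉ sphere 0 R :=
    measure_eq_zero_iff_ae_notMem.1 (Measure.addHaar_sphere_of_ne_zero volume 0 hR.ne')
  rw [← integral_indicator measurableSet_ball.compl]
  calc _ ≤ ∫ x : EuclideanSpace ℝ (Fin N),
        R ^ (-(2 * (N : ℝ) + 6 * s)) * K * g ‖R⁻¹ • x‖ := by
        refine integral_mono_of_nonneg (.of_forall fun x ↦ ?_) hint ?_
        · refine Set.indicator_nonneg (fun x hx ↦ ?_) x
          have hx' : R ≤ ‖x‖ := by simpa using hx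
          refine mul_nonneg (by positivity)
            (setIntegral_nonneg measurableSet_ball fun y hy ↦ ?_)
          rw [mem_ball_zero_iff] at hy
          exact inv_nonneg.2 (sub_nonneg.2
            (pow_le_pow_left₀ (norm_nonneg y) (hy.le.trans hx') N))
        · filter_upwards [hsphere] with x hx
          rw [mem_sphere_zero_iff_norm] at hx
          by_cases hxR : ‖x‖ < R
          · rw [Set.indicator_of_notMem (by simpa using hxR)]
            exact mul_nonneg (by positivity) (hg0 _)
          · have hxR' : R < ‖x‖ := lt_of_le_of_ne (not_lt.1 hxR) (Ne.symm hx)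
            have hnorm : ‖R⁻¹ • x‖ = ‖x‖ / R := by
              rw [norm_smul, norm_inv, Real.norm_of_nonneg hR.le, inv_mul_eq_div]
            rw [Set.indicator_of_mem (by simpa using hxR), hnorm, hgdef,
              Set.indicator_of_mem (by exact (one_lt_div hR).2 hxR')]
            calc _ ≤ (R ^ (-(2 * (N : ℝ) + 6 * s)) * ((‖x‖ / R) ^ N)⁻¹) *
                  ((√((‖x‖ / R) ^ N - 1))⁻¹ * K) :=
                  mul_le_mul_of_nonneg (inv_one_add_rpow_sq_mul_inv_rpow_le hs0 hR hxR'.le)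
                    (hinner R ‖x‖ hR hxR') (by positivity) (by positivity)
              _ = _ := by ring
    _ = K * L * R ^ (-((N : ℝ) + 6 * s)) := by
        rw [integral_const_mul, Measure.integral_comp_inv_smul_of_nonneg volume
          (fun x : EuclideanSpace ℝ (Fin N) ↦ g ‖x‖) hR.le, hfin, smul_eq_mul,
          show -((N : ℝ) + 6 * s) = -(2 * (N : ℝ) + 6 * s) + N by ring, Real.rpow_add hR,
          Real.rpow_natCast]
        ring
    _ ≤ (K * L + 1) * R ^ (-((N : ℝ) + 6 * s)) := by
        gcongr
        linarith
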